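/- Static-regimen specialization: suppose every d ∈ 𝒟 is static, i.e. each map d_t is constant with value ā^d_t, and that the induced treatment sequences ā^d = (ā^d_0, …, ā^d_K) are pairwise distinct across 𝒟. Then σ²_{K+1} := E_p[ C² · (y(l_{K+1}) − Q̄(ā(K), l̄(K)))² ] = Σ_{d∈𝒟} h(d,K+1)² · Σ_{l̄(K)} P^d_K(l̄(K)) · Q̄(1 − Q̄)(ā^d, l̄(K)) / g_{0:K}(ā^d, l̄(K)). -/

import Mathlib

/-!
Longitudinal data with a binary final outcome: `O = (l̄(K), ā(K), Y)` with `Y : Bool`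
(`y(true) = 1`, `y(false) = 0`), full-support pmf `p`, treatment mechanism factors `g_t`,
covariate factors `q_t`, outcome regression `Q̄(ā(K), l̄(K)) = q_{K+1}(true ∣ l̄(K), ā(K))`,
a finite family `𝒟` of regimens with weights `h(·, K+1)`, and the time-`(K+1)` component
`D*_{K+1} = C · (y - Q̄)` of the working-MSM efficient influence function.
-/

open Finset
open scoped Classical

noncomputable section

variable {K : ℕ} {L : Fin (K + 1) → Type} {A : Fin (K + 1) → Type}

/-- Covariate histories `l̄(K)`. -/
abbrev Cov (K : ℕ) (L : Fin (K + 1) → Type) : Type := ∀ s : Fin (K + 1), L s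

/-- Treatment histories `ā(K)`. -/
abbrev Trt (K : ℕ) (A : Fin (K + 1) → Type) : Type := ∀ s : Fin (K + 1), A s

/-- Observations `(l̄(K), ā(K), Y)` with binary outcome `Y`. -/
abbrev Obs (K : ℕ) (L : Fin (K + 1) → Type) (A : Fin (K + 1) → Type) : Type :=
  Cov K L × Trt K A × Bool

/-- Agreement of covariate histories on indices `< t`. -/
def aL (t : ℕ) (l l' : Cov K L) : Prop := ∀ s : Fin (K + 1), (s : ℕ) < t → l s = l' s

/-- Agreement of treatment histories on indices `< t`. -/
def aA (t : ℕ) (a a' : Trt K A) : Prop := ∀ s : Fin (K + 1), (s : ℕ) < t → a s = a' s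

variable [∀ t, Fintype (L t)] [∀ t, Fintype (A t)]

/-- Mass of the event that covariates agree with `l` on indices `< tL` and treatments agree
with `a` on indices `< tA`. -/
def marg (p : Obs K L A → ℝ) (tL tA : ℕ) (l : Cov K L) (a : Trt K A) : ℝ :=
  ∑ o' : Obs K L A, if aL tL l o'.1 ∧ aA tA a o'.2.1 then p o' else 0

/-- Mass of the event that covariates and treatments agree with `(l, a)` everywhere and the
binary outcome equals `true`. -/
def margY (p : Obs K L A → ℝ) (l : Cov K L) (a : Trt K A) : ℝ :=
  ∑ o' : Obs K L A,
    if aL (K + 1) l o'.1 ∧ aA (K + 1) a o'.2.1 ∧ o'.2.2 = true then p o' else 0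

/-- The outcome regression `Q̄(ā(K), l̄(K)) = q_{K+1}(true ∣ l̄(K), ā(K))`. -/
def Qb (p : Obs K L A → ℝ) (l : Cov K L) (a : Trt K A) : ℝ :=
  margY p l a / marg p (K + 1) (K + 1) l a

/-- The conditional factor `q_t(l_t ∣ l̄(t-1), ā(t-1))` (for `t ≤ K`). -/
def qC (p : Obs K L A → ℝ) (t : ℕ) (l : Cov K L) (a : Trt K A) : ℝ :=
  marg p (t + 1) t l a / marg p t t l a

/-- The treatment mechanism factor `g_t(a_t ∣ l̄(t), ā(t-1))`. -/
def gC (p : Obs K L A → ℝ) (t : ℕ) (l : Cov K L) (a : Trt K A) : ℝ :=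
  marg p (t + 1) (t + 1) l a / marg p (t + 1) t l a

/-- The cumulative treatment probability `g_{0:t-1}`; `g_{0:K} = gCum p (K + 1)`. -/
def gCum (p : Obs K L A → ℝ) (t : ℕ) (l : Cov K L) (a : Trt K A) : ℝ :=
  ∏ m ∈ Finset.range t, gC p m l a

/-- The treatment history determined by the regimen `d` along the covariates `l`. -/
def aOf (d : ∀ t : Fin (K + 1), Cov K L → A t) (l : Cov K L) : Trt K A := fun s => d s l

/-- A regimen is adapted: `d_t` depends only on `l̄(t)`. -/
def Adapted (d : ∀ t : Fin (K + 1), Cov K L → A t) : Prop :=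
  ∀ t : Fin (K + 1), ∀ l l' : Cov K L, aL ((t : ℕ) + 1) l l' → d t l = d t l'

/-- The event `ā(K) = d(l̄(K))`. -/
def followsAll (d : ∀ t : Fin (K + 1), Cov K L → A t) (l : Cov K L) (a : Trt K A) : Prop :=
  ∀ s : Fin (K + 1), a s = d s l

/-- The real-valued binary outcome: `y(true) = 1`, `y(false) = 0`. -/
def yB (b : Bool) : ℝ := if b then 1 else 0

/-- The weight `C(ā(K), l̄(K)) = Σ_{d ∈ 𝒟} h(d,K+1) 1{ā(K) = d(l̄(K))} / g_{0:K}(ā(K), l̄(K))`. -/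
def Cw {D : Type} [Fintype D] (p : Obs K L A → ℝ)
    (ds : D → ∀ t : Fin (K + 1), Cov K L → A t) (h : D → ℝ)
    (l : Cov K L) (a : Trt K A) : ℝ :=
  ∑ i : D, h i * ((if followsAll (ds i) l a then (1 : ℝ) else 0) / gCum p (K + 1) l a)

/-- The G-computation mass `P^d_K(l̄(K)) = Π_{m=0}^{K} q_m(l_m ∣ l̄(m-1), d(l̄(m-1)))`. -/
def PdK (p : Obs K L A → ℝ) (d : ∀ t : Fin (K + 1), Cov K L → A t) (l : Cov K L) : ℝ :=
  ∏ m ∈ Finset.range (K + 1), qC p m l (aOf d l)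

set_option linter.unusedSectionVars false in
theorem aL_last_iff {l l' : Cov K L} : aL (K + 1) l l' ↔ l = l' :=
  ⟨fun h => funext fun s => h s s.isLt, fun h _ _ => congrFun h _⟩

set_option linter.unusedSectionVars false in
theorem aA_last_iff {a a' : Trt K A} : aA (K + 1) a a' ↔ a = a' :=
  ⟨fun h => funext fun s => h s s.isLt, fun h _ _ => congrFun h _⟩

set_option linter.unusedSectionVars false in
theorem followsAll_iff {d : ∀ t : Fin (K + 1), Cov K L → A t} {l : Cov K L} {a : Trt K A} :
    followsAll d l a ↔ a = aOf d l :=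
  funext_iff.symm

theorem marg_last (p : Obs K L A → ℝ) (l : Cov K L) (a : Trt K A) :
    marg p (K + 1) (K + 1) l a = p (l, a, true) + p (l, a, false) := by
  simp only [marg, aL_last_iff, aA_last_iff, ite_and, Fintype.sum_prod_type]
  simp [Finset.sum_add_distrib]

theorem margY_eq (p : Obs K L A → ℝ) (l : Cov K L) (a : Trt K A) :
    margY p l a = p (l, a, true) := by
  simp only [margY, aL_last_iff, aA_last_iff, ite_and, Fintype.sum_prod_type]
  simp

theorem marg_zero (p : Obs K L A → ℝ) (l : Cov K L) (a : Trt K A) :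
    marg p 0 0 l a = ∑ o, p o := by
  simp [marg, aL, aA]

theorem marg_pos {p : Obs K L A → ℝ} (hp : ∀ o, 0 < p o) (tL tA : ℕ)
    (l : Cov K L) (a : Trt K A) : 0 < marg p tL tA l a := by
  refine Finset.sum_pos' (fun o _ => ?_) ⟨(l, a, true), Finset.mem_univ _, ?_⟩
  · split_ifs
    exacts [(hp o).le, le_rfl]
  · simp [aL, aA, hp]

theorem gCum_pos {p : Obs K L A → ℝ} (hp : ∀ o, 0 < p o) (t : ℕ)
    (l : Cov K L) (a : Trt K A) : 0 < gCum p t l a :=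
  Finset.prod_pos fun _ _ => div_pos (marg_pos hp _ _ l a) (marg_pos hp _ _ l a)

/-- The joint mass of a history factors into covariate and treatment factors. -/
theorem prod_qC_mul_gCum {p : Obs K L A → ℝ} (hp : ∀ o, 0 < p o) (hp1 : ∑ o, p o = 1)
    (t : ℕ) (l : Cov K L) (a : Trt K A) :
    (∏ m ∈ Finset.range t, qC p m l a) * gCum p t l a = marg p t t l a := by
  induction t with
  | zero => simp [gCum, marg_zero, hp1]
  | succ t ih =>
    have h₁ := (marg_pos hp t t l a).ne'
    have h₂ := (marg_pos hp (t + 1) t l a).ne'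
    have hg : gCum p (t + 1) l a = gCum p t l a * gC p t l a := Finset.prod_range_succ _ _
    rw [Finset.prod_range_succ, hg, mul_mul_mul_comm, ih, qC, gC]
    field_simp

/-- The conditional variance of the binary outcome is `Q̄ (1 - Q̄)`. -/
theorem sum_outcome_residual_sq {p : Obs K L A → ℝ} (hp : ∀ o, 0 < p o)
    (l : Cov K L) (a : Trt K A) :
    ∑ b : Bool, p (l, a, b) * (yB b - Qb p l a) ^ 2
      = marg p (K + 1) (K + 1) l a * (Qb p l a * (1 - Qb p l a)) := by
  have h := (add_pos (hp (l, a, true)) (hp (l, a, false))).ne'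
  simp only [Fintype.sum_bool, yB, Qb, marg_last, margY_eq, if_true, Bool.false_eq_true, if_false]
  field_simp
  ring

/-- If at most one regimen is followed at each history, the cross terms of `C²` vanish. -/
theorem Cw_sq {D : Type} [Fintype D] (p : Obs K L A → ℝ)
    (ds : D → ∀ t : Fin (K + 1), Cov K L → A t) (h : D → ℝ) {l : Cov K L}
    (hinj : Function.Injective fun i => aOf (ds i) l) (a : Trt K A) :
    Cw p ds h l a ^ 2
      = ∑ i : D, if a = aOf (ds i) l then h i ^ 2 / gCum p (K + 1) l a ^ 2 else 0 := by
  simp only [Cw, followsAll_iff]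
  by_cases hex : ∃ j, a = aOf (ds j) l
  · obtain ⟨j, rfl⟩ := hex
    have hj : ∀ i, aOf (ds j) l = aOf (ds i) l ↔ j = i := fun i => hinj.eq_iff
    simp only [hj, ite_div, mul_ite, zero_div, mul_zero, Finset.sum_ite_eq, Finset.mem_univ,
      if_true]
    ring
  · push Not at hex
    simp [hex]

/-- static-regimen specialization. If every regimen in `𝒟` is static (each `d_t`
is a constant map) and the induced treatment sequences are pairwise distinct, then
`σ²_{K+1} = Σ_{d ∈ 𝒟} h(d,K+1)² Σ_{l̄(K)} P^d_K(l̄(K)) Q̄(1-Q̄)(ā^d, l̄(K)) / g_{0:K}(ā^d, l̄(K))`. -/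
theorem msm_last_component_static [∀ t, Nonempty (L t)] [∀ t, Nonempty (A t)]
    {D : Type} [Fintype D] [Nonempty D]
    (p : Obs K L A → ℝ) (hp : ∀ o, 0 < p o) (hp1 : ∑ o : Obs K L A, p o = 1)
    (ds : D → ∀ t : Fin (K + 1), Cov K L → A t)
    (hstatic : ∀ i : D, ∀ t : Fin (K + 1), ∀ l l' : Cov K L, ds i t l = ds i t l')
    (hdist : ∀ i j : D, i ≠ j → ∃ (t : Fin (K + 1)) (l : Cov K L), ds i t l ≠ ds j t l)
    (h : D → ℝ) :
    ∑ o : Obs K L A, p o * (Cw p ds h o.1 o.2.1 ^ 2 * (yB o.2.2 - Qb p o.1 o.2.1) ^ 2)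
      = ∑ i : D, h i ^ 2 *
          ∑ l : Cov K L, PdK p (ds i) l *
            (Qb p l (aOf (ds i) l) * (1 - Qb p l (aOf (ds i) l))) /
            gCum p (K + 1) l (aOf (ds i) l) := by
  have hinj (l : Cov K L) : Function.Injective fun i => aOf (ds i) l := by
    intro i j hij
    by_contra hne
    obtain ⟨t, l', ht⟩ := hdist i j hne
    exact ht ((hstatic i t l' l).trans ((congrFun hij t).trans (hstatic j t l l')))
  calc
    _ = ∑ l : Cov K L, ∑ a : Trt K A, Cw p ds h l a ^ 2 *
          (marg p (K + 1) (K + 1) l a * (Qb p l a * (1 - Qb p l a))) := by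
      simp only [Fintype.sum_prod_type, ← sum_outcome_residual_sq hp, Finset.mul_sum,
        mul_left_comm]
    _ = ∑ l : Cov K L, ∑ i : D, h i ^ 2 / gCum p (K + 1) l (aOf (ds i) l) ^ 2 *
          (marg p (K + 1) (K + 1) l (aOf (ds i) l) *
            (Qb p l (aOf (ds i) l) * (1 - Qb p l (aOf (ds i) l)))) := by
      refine Finset.sum_congr rfl fun l _ => ?_
      simp only [Cw_sq p ds h (hinj l), Finset.sum_mul, ite_mul, zero_mul]
      rw [Finset.sum_comm]
      simp only [Finset.sum_ite_eq', Finset.mem_univ, if_true]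
    _ = _ := by
      rw [Finset.sum_comm]
      refine Finset.sum_congr rfl fun i _ => ?_
      rw [Finset.mul_sum]
      refine Finset.sum_congr rfl fun l _ => ?_
      have hg := (gCum_pos hp (K + 1) l (aOf (ds i) l)).ne'
      rw [← prod_qC_mul_gCum hp hp1, PdK]
      field_simp


end
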